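/- arXiv:1105.0596 — 5 statements merged into one kernel-verified Lean document; each statement's English description precedes it below -/
import Mathlib

section
/- Let m, m' : Fin n → ℤ. Then the monomials satisfy the product rule u^m * u^{m'} = (∏_{i < j} (q j i)^{(m j)·(m' i)}) • u^{m + m'}, where the product of the scalars (q j i)^{(m j)(m' i)} is taken in Fˣ over all pairs i < j and acts on R by scalar multiplication. (Proposition 1.1(i), McConnell–Pettit.) -/
/-- The ordered monomial `u₁^{m₁} ⋯ u_n^{m_n}` (product over `i` in increasing order),
an element of the group of units `Rˣ`. -/
noncomputable def umon {R : Type*} [Ring R] {n : ℕ} (u : Fin n → Rˣ) (m : Fin n → ℤ) : Rˣ :=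
  ((List.finRange n).map (fun i => u i ^ m i)).prod

theorem aux_pow {G A : Type*} [Group G] [CommGroup A] (φ : A →* G)
    (hc : ∀ a g, φ a * g = g * φ a) (x y : G) (z : A) (h : x * y = φ z * (y * x)) (b : ℤ) :
    x * y ^ b = φ (z ^ b) * (y ^ b * x) := by
  have h1 : x * y * x⁻¹ = φ z * y := by rw [h]; group
  have h2 : x * y ^ b * x⁻¹ = φ z ^ b * y ^ b := by
    rw [← conj_zpow, h1]
    exact (show Commute (φ z) y from hc z y).mul_zpow b
  rw [map_zpow, ← mul_assoc, ← h2]; group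

theorem aux_pow2 {G A : Type*} [Group G] [CommGroup A] (φ : A →* G)
    (hc : ∀ a g, φ a * g = g * φ a) (x y : G) (z : A) (h : x * y = φ z * (y * x)) (a b : ℤ) :
    x ^ a * y ^ b = φ (z ^ (a * b)) * (y ^ b * x ^ a) := by
  have h1 := aux_pow φ hc x y z h b
  have h2 : y ^ b * x = φ ((z ^ b)⁻¹) * (x * y ^ b) := by
    rw [h1, map_inv]; group
  have h3 := aux_pow φ hc _ _ _ h2 a
  rw [h3, ← mul_assoc, ← map_mul, mul_comm a b, zpow_mul, inv_zpow, mul_inv_cancel, map_one,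
    one_mul]

theorem aux_list {G A ι : Type*} [Group G] [CommGroup A] (φ : A →* G)
    (hc : ∀ a g, φ a * g = g * φ a) (v : ι → G) (c : ι → A) (y : G)
    (h : ∀ i, v i * y = φ (c i) * (y * v i)) (l : List ι) :
    (l.map v).prod * y = φ ((l.map c).prod) * (y * (l.map v).prod) := by
  induction l with
  | nil => simp
  | cons i l ih =>
    simp only [List.map_cons, List.prod_cons, map_mul]
    calc v i * (l.map v).prod * y = v i * φ (l.map c).prod * y * (l.map v).prod := by
          rw [mul_assoc, ih]; simp only [mul_assoc]
      _ = φ (l.map c).prod * (v i * y) * (l.map v).prod := by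
          rw [← hc]; simp only [mul_assoc]
      _ = φ (l.map c).prod * φ (c i) * (y * v i) * (l.map v).prod := by
          rw [h]; simp only [mul_assoc]
      _ = _ := by rw [hc (l.map c).prod]; simp only [mul_assoc]

theorem aux_main {G A : Type*} [Group G] [CommGroup A] (φ : A →* G)
    (hc : ∀ a g, φ a * g = g * φ a) {n : ℕ} (q : Fin n → Fin n → A) (u : Fin n → G)
    (hu : ∀ i j, u i * u j = φ (q i j) * (u j * u i)) (m m' : Fin n → ℤ) :
    ((List.finRange n).map (fun i => u i ^ m i)).prod *
      ((List.finRange n).map (fun i => u i ^ m' i)).prod =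
    φ (∏ i, ∏ j, if j < i then q i j ^ (m i * m' j) else 1) *
      ((List.finRange n).map (fun i => u i ^ (m + m') i)).prod := by
  induction n with
  | zero => simp
  | succ n ih =>
    have ih' := ih (fun i j => q i.succ j.succ) (fun i => u i.succ) (fun i j => hu _ _)
      (fun i => m i.succ) (fun i => m' i.succ)
    have hl := aux_list φ hc (fun i : Fin n => u i.succ ^ m i.succ)
      (fun i => q i.succ 0 ^ (m i.succ * m' 0)) (u 0 ^ m' 0)
      (fun i => aux_pow2 φ hc _ _ _ (hu _ _) _ _) (List.finRange n)
    simp only [List.finRange_succ, List.map_cons, List.prod_cons, List.map_map, Function.comp_def,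
      Fin.prod_univ_succ, Fin.succ_lt_succ_iff, Fin.not_lt_zero, Fin.succ_pos, if_true, if_false,
      Finset.prod_const_one, one_mul, Finset.prod_mul_distrib, map_mul, Pi.add_apply] at ih' ⊢
    rw [← Fin.prod_univ_def] at hl
    generalize ((List.finRange n).map (fun i => u i.succ ^ m i.succ)).prod = T at *
    generalize ((List.finRange n).map (fun i => u i.succ ^ m' i.succ)).prod = T' at *
    generalize ((List.finRange n).map (fun i => u i.succ ^ (m i.succ + m' i.succ))).prod = S at *
    generalize (∏ i : Fin n, q i.succ 0 ^ (m i.succ * m' 0)) = P at *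
    generalize (∏ i : Fin n, ∏ j : Fin n, if j < i then _ else (1 : A)) = Q at *
    calc u 0 ^ m 0 * T * (u 0 ^ m' 0 * T') = u 0 ^ m 0 * (T * u 0 ^ m' 0) * T' := by
          simp only [mul_assoc]
      _ = (u 0 ^ m 0 * φ P) * u 0 ^ m' 0 * (T * T') := by rw [hl]; simp only [mul_assoc]
      _ = φ P * ((u 0 ^ m 0 * u 0 ^ m' 0) * φ Q) * S := by
          rw [ih', ← hc]; simp only [mul_assoc]
      _ = _ := by rw [← hc, ← zpow_add]; simp only [mul_assoc]

/-- Proposition 1.1(i) of McConnell–Pettit: the product rule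
`u^m * u^{m'} = (∏_{i < j} (q j i)^{(m j)(m' i)}) • u^{m + m'}`. -/
theorem monomial_mul {F : Type*} [Field F] {n : ℕ} (hn : 0 < n)
    (q : Fin n → Fin n → Fˣ) (hq1 : ∀ i, q i i = 1) (hq2 : ∀ i j, q j i = (q i j)⁻¹)
    {R : Type*} [Ring R] [Algebra F R] (u : Fin n → Rˣ)
    (hu : ∀ i j, (u i : R) * (u j : R) = (q i j : F) • ((u j : R) * (u i : R)))
    (m m' : Fin n → ℤ) :
    (umon u m : R) * (umon u m' : R) =
      (((∏ p ∈ Finset.univ.filter (fun p : Fin n × Fin n => p.2 < p.1),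
          q p.1 p.2 ^ (m p.1 * m' p.2) : Fˣ) : F)) • (umon u (m + m') : R) := by
  have key := aux_main (Units.map (algebraMap F R).toMonoidHom)
    (fun a g => Units.ext (Algebra.commutes (a : F) (g : R))) q u
    (fun i j => Units.ext (by simpa [Algebra.smul_def] using hu i j)) m m'
  have key2 := congrArg (Units.val) key
  rw [Finset.prod_filter, Fintype.prod_prod_type, Algebra.smul_def]
  exact key2
end

section
/- Let m : Fin n → ℤ. Then the inverse of the monomial u^m is given by (u^m)⁻¹ = μ(m) • u^{-m}, where μ(m) = ∏_{i < j} (q j i)^{(m j)·(m i)} ∈ Fˣ. (Proposition 1.1(ii), McConnell–Pettit.) -/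
/-- `x` and `y` commute up to the central element `c a`. -/
def QC {A G : Type*} [CommGroup A] [Group G] (c : A →* G) (x y : G) (a : A) : Prop :=
  x * y = c a * (y * x)

theorem QC.symm {A G : Type*} [CommGroup A] [Group G] {c : A →* G}
    {x y : G} {a : A} (h : QC c x y a) : QC c y x a⁻¹ := by
  unfold QC at *
  rw [h, map_inv, inv_mul_cancel_left]

theorem QC.zpow {A G : Type*} [CommGroup A] [Group G] {c : A →* G}
    (hc : ∀ a g, c a * g = g * c a)
    {x y : G} {a : A} (h : QC c x y a) (k : ℤ) : QC c (x ^ k) y (a ^ k) := by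
  unfold QC at *
  have h1 : SemiconjBy y (c a * x) x := by
    unfold SemiconjBy
    rw [h, ← mul_assoc, ← hc, mul_assoc]
  have h2 := h1.zpow_right k
  have h3 : Commute (c a) x := hc a x
  rw [h3.mul_zpow] at h2
  unfold SemiconjBy at h2
  rw [← h2, map_zpow, ← map_zpow, ← mul_assoc, ← hc, mul_assoc]

theorem QC.zpow_zpow {A G : Type*} [CommGroup A] [Group G] {c : A →* G}
    (hc : ∀ a g, c a * g = g * c a)
    {x y : G} {a : A} (h : QC c x y a) (k l : ℤ) : QC c (x ^ k) (y ^ l) (a ^ (k * l)) := by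
  have := ((h.zpow hc k).symm.zpow hc l).symm
  rwa [← inv_zpow, inv_inv, ← zpow_mul] at this

theorem QC.inv_inv {A G : Type*} [CommGroup A] [Group G] {c : A →* G}
    (hc : ∀ a g, c a * g = g * c a)
    {x y : G} {a : A} (h : QC c x y a) : QC c x⁻¹ y⁻¹ a := by
  simpa using h.zpow_zpow hc (-1) (-1)

theorem QC.list_prod {A G : Type*} [CommGroup A] [Group G] {c : A →* G}
    (hc : ∀ a g, c a * g = g * c a) {ι : Type*} (l : List ι) (x : ι → G) (y : G) (a : ι → A)
    (h : ∀ i, QC c (x i) y (a i)) : QC c (l.map x).prod y (l.map a).prod := by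
  induction l with
  | nil => simp [QC]
  | cons i l ih =>
    simp only [List.map_cons, List.prod_cons]
    have hi := h i
    unfold QC at *
    rw [mul_assoc, ih, ← mul_assoc, ← hc, mul_assoc, ← mul_assoc (x i), hi, mul_comm (a i),
      map_mul]
    simp only [mul_assoc]

theorem QC.prod_inv {A G : Type*} [CommGroup A] [Group G] {c : A →* G}
    (hc : ∀ a g, c a * g = g * c a) {n : ℕ} (v : Fin n → G) (s : Fin n → Fin n → A)
    (h : ∀ i j, QC c (v i) (v j) (s i j)) :
    (((List.finRange n).map v).prod)⁻¹ =
      c (∏ i, ∏ j, if j < i then s i j else 1) *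
        ((List.finRange n).map (fun i => (v i)⁻¹)).prod := by
  induction n with
  | zero => simp
  | succ n ih =>
    have ih' := ih (fun i => v i.succ) (fun i j => s i.succ j.succ) (fun i j => h _ _)
    have hp := QC.list_prod hc (List.finRange n) (fun i => (v i.succ)⁻¹) (v 0)⁻¹
      (fun i => s i.succ 0) (fun i => (h _ _).inv_inv hc)
    unfold QC at hp
    simp only [List.finRange_succ, List.map_cons, List.map_map, List.prod_cons, mul_inv_rev,
      Function.comp_def]
    rw [ih', mul_assoc, hp, ← mul_assoc, ← map_mul]
    congr 2
    simp [Fin.prod_univ_succ, Finset.prod_mul_distrib, mul_comm, ← List.ofFn_eq_map,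
      List.prod_ofFn]

/-- Proposition 1.1(ii) of McConnell–Pettit: the inverse of a monomial is given by
`(u^m)⁻¹ = μ(m) • u^{-m}` where `μ(m) = ∏_{i < j} (q j i)^{(m j)(m i)} ∈ Fˣ`. -/
theorem monomial_inv {F : Type*} [Field F] {n : ℕ} (hn : 0 < n)
    (q : Fin n → Fin n → Fˣ) (hq1 : ∀ i, q i i = 1) (hq2 : ∀ i j, q j i = (q i j)⁻¹)
    {R : Type*} [Ring R] [Algebra F R] (u : Fin n → Rˣ)
    (hu : ∀ i j, (u i : R) * (u j : R) = (q i j : F) • ((u j : R) * (u i : R)))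
    (m : Fin n → ℤ) :
    (((umon u m)⁻¹ : Rˣ) : R) =
      (((∏ p ∈ Finset.univ.filter (fun p : Fin n × Fin n => p.2 < p.1),
          q p.1 p.2 ^ (m p.1 * m p.2) : Fˣ) : F)) • (umon u (-m) : R) := by
  have hc : ∀ (a : Fˣ) (g : Rˣ), Units.map (algebraMap F R : F →* R) a * g =
      g * Units.map (algebraMap F R : F →* R) a := by
    intro a g
    ext
    simpa using Algebra.commutes (a : F) (g : R)
  have hQ : ∀ i j, QC (Units.map (algebraMap F R : F →* R)) (u i ^ m i) (u j ^ m j)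
      (q i j ^ (m i * m j)) := by
    intro i j
    apply QC.zpow_zpow hc
    unfold QC
    ext
    simpa [Algebra.smul_def] using hu i j
  have key := congrArg (Units.val) (QC.prod_inv hc _ _ hQ)
  have e : (∏ p ∈ Finset.univ.filter (fun p : Fin n × Fin n => p.2 < p.1),
      q p.1 p.2 ^ (m p.1 * m p.2)) =
      ∏ i, ∏ j, if j < i then q i j ^ (m i * m j) else 1 := by
    rw [Finset.prod_filter, ← Finset.univ_product_univ, Finset.prod_product]
  rw [e, Algebra.smul_def]
  unfold umon
  simp only [Pi.neg_apply, zpow_neg]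
  exact key
end

section
/- Let a, b : Fin n → ℤ. Then the group-theoretic commutator [u^a, u^b] = (u^a)(u^b)(u^a)⁻¹(u^b)⁻¹, computed in the group of units Rˣ, equals the scalar unit (∏_{i < j} (q j i)^{(a j)(b i) − (a i)(b j)}) • 1; in particular the commutator of any two monomials lies in F·1. (Proposition 1.1(iv), McConnell–Pettit.) -/
section helpers
variable {A G : Type*} [CommGroup A] [Group G] (f : A →* G)

theorem mc_symm (hf : ∀ c x, Commute (f c) x) {x y : G} {c : A} (h : x * y = f c * (y * x)) :
    y * x = f c⁻¹ * (x * y) := by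
  rw [h, ← mul_assoc, ← map_mul]; simp

theorem mc_mul (hf : ∀ c x, Commute (f c) x) {x x' y : G} {c c' : A}
    (h : x * y = f c * (y * x)) (h' : x' * y = f c' * (y * x')) :
    (x * x') * y = f (c * c') * (y * (x * x')) := by
  have e := (hf c' x).eq
  calc (x * x') * y = x * (x' * y) := by group
    _ = (x * f c') * (y * x') := by rw [h']; group
    _ = f c' * (x * y) * x' := by rw [← e]; group
    _ = f c' * f c * (y * (x * x')) := by rw [h]; group
    _ = _ := by rw [← map_mul, mul_comm c']

theorem mc_zpow (hf : ∀ c x, Commute (f c) x) {x y : G} {c : A}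
    (h : x * y = f c * (y * x)) (k : ℤ) :
    x * y ^ k = f (c ^ k) * (y ^ k * x) := by
  have h1 : SemiconjBy x y (f c * y) := by
    unfold SemiconjBy; rw [h, mul_assoc]
  have h2 := (h1.zpow_right k).eq
  rw [h2, (hf c y).mul_zpow, map_zpow, mul_assoc]

theorem mc_list (hf : ∀ c x, Commute (f c) x) {ι : Type*} (l : List ι) (x : ι → G) (y : G)
    (c : ι → A) (h : ∀ i, x i * y = f (c i) * (y * x i)) :
    (l.map x).prod * y = f (l.map c).prod * (y * (l.map x).prod) := by
  induction l with
  | nil => simp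
  | cons i l ih => simpa only [List.map_cons, List.prod_cons] using mc_mul f hf (h i) ih

end helpers

theorem mc_prod {A : Type*} [CommGroup A] {n : ℕ} (q : Fin n → Fin n → A)
    (hq1 : ∀ i, q i i = 1) (hq2 : ∀ i j, q j i = (q i j)⁻¹) (a b : Fin n → ℤ) :
    ∏ i, ∏ j, q i j ^ (a i * b j) =
      ∏ p ∈ Finset.univ.filter (fun p : Fin n × Fin n => p.2 < p.1),
          q p.1 p.2 ^ (a p.1 * b p.2 - a p.2 * b p.1) := by
  rw [Finset.prod_filter, Fintype.prod_prod_type]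
  have e : ∀ i j, q i j ^ (a i * b j) =
      (if j < i then q i j ^ (a i * b j) else 1) * (if i < j then q i j ^ (a i * b j) else 1) := by
    intro i j
    rcases lt_trichotomy i j with h | h | h
    · simp [h, h.not_gt]
    · subst h; simp [hq1]
    · simp [h, h.not_gt]
  rw [Finset.prod_congr rfl fun i _ => (Finset.prod_congr rfl fun j _ => e i j).trans
    Finset.prod_mul_distrib, Finset.prod_mul_distrib]
  rw [Finset.prod_comm (f := fun i j => if i < j then q i j ^ (a i * b j) else 1),
    ← Finset.prod_mul_distrib]
  refine Finset.prod_congr rfl fun i _ => ?_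
  rw [← Finset.prod_mul_distrib]
  refine Finset.prod_congr rfl fun j _ => ?_
  split_ifs with h
  · rw [hq2 i j, inv_zpow, zpow_sub]
  · simp

/-- Proposition 1.1(iv) of McConnell–Pettit: the group-theoretic commutator
`[u^a, u^b] = u^a u^b (u^a)⁻¹ (u^b)⁻¹`, computed in `Rˣ`, equals the scalar unit
`(∏_{i < j} (q j i)^{(a j)(b i) - (a i)(b j)}) • 1`; in particular it lies in `F·1`. -/
theorem monomial_commutator {F : Type*} [Field F] {n : ℕ} (hn : 0 < n)
    (q : Fin n → Fin n → Fˣ) (hq1 : ∀ i, q i i = 1) (hq2 : ∀ i j, q j i = (q i j)⁻¹)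
    {R : Type*} [Ring R] [Algebra F R] (u : Fin n → Rˣ)
    (hu : ∀ i j, (u i : R) * (u j : R) = (q i j : F) • ((u j : R) * (u i : R)))
    (a b : Fin n → ℤ) :
    ((umon u a * umon u b * (umon u a)⁻¹ * (umon u b)⁻¹ : Rˣ) : R) =
      (((∏ p ∈ Finset.univ.filter (fun p : Fin n × Fin n => p.2 < p.1),
          q p.1 p.2 ^ (a p.1 * b p.2 - a p.2 * b p.1) : Fˣ) : F)) • (1 : R) := by
  let f : Fˣ →* Rˣ := Units.map (algebraMap F R : F →* R)
  have hf : ∀ c x, Commute (f c) x := fun c x => by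
    apply Units.ext
    exact Algebra.commutes (c : F) (x : R)
  have h0 : ∀ i j, u i * u j = f (q i j) * (u j * u i) := fun i j => by
    apply Units.ext
    have := hu i j
    rw [Algebra.smul_def] at this
    simpa [f] using this
  have h1 : ∀ i j, u i ^ a i * u j ^ b j = f (q i j ^ (a i * b j)) * (u j ^ b j * u i ^ a i) := by
    intro i j
    have h := mc_symm f hf (mc_zpow f hf (mc_symm f hf (mc_zpow f hf (h0 i j) (b j))) (a i))
    rw [h]
    congr 2
    rw [inv_zpow, inv_inv, ← zpow_mul, mul_comm]
  have h2 : ∀ i, u i ^ a i * umon u b = f (∏ j, q i j ^ (a i * b j)) * (umon u b * u i ^ a i) := by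
    intro i
    have h := mc_symm f hf (mc_list f hf (List.finRange n) (fun j => u j ^ b j) (u i ^ a i)
      (fun j => (q i j ^ (a i * b j))⁻¹) (fun j => mc_symm f hf (h1 i j)))
    rw [← Fin.prod_univ_def, Finset.prod_inv_distrib, inv_inv] at h
    exact h
  have h3 := mc_list f hf (List.finRange n) (fun i => u i ^ a i) (umon u b) _ h2
  rw [← Fin.prod_univ_def, mc_prod q hq1 hq2] at h3
  change umon u a * umon u b = _ * (umon u b * umon u a) at h3
  rw [h3, Algebra.smul_def, mul_one]
  generalize (∏ p ∈ Finset.univ.filter (fun p : Fin n × Fin n => p.2 < p.1),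
          q p.1 p.2 ^ (a p.1 * b p.2 - a p.2 * b p.1)) = c
  have : f c * (umon u b * umon u a) * (umon u a)⁻¹ * (umon u b)⁻¹ = f c := by group
  rw [this]
  rfl
end

section
/- Let F be a field and let M₁, M₂ be F-vector spaces. For i = 1, 2, let L_i : ℝ → Submodule F M_i be a family of subspaces that is decreasing (L_i ν ≥ L_i μ whenever ν ≤ μ), exhaustive (⋃_{μ ∈ ℝ} L_i μ = M_i), and everywhere proper (L_i μ ≠ M_i for every μ ∈ ℝ). For λ ∈ ℝ define L λ = Σ_{μ + ν = λ} (L₁ μ) ⊗ (L₂ ν), the subspace of M₁ ⊗_F M₂ spanned by the images of L₁ μ ⊗ L₂ ν over all pairs (μ, ν) of reals with μ + ν = λ. Then the family L : ℝ → Submodule F (M₁ ⊗_F M₂) is decreasing, exhaustive, and everywhere proper (L λ ≠ M₁ ⊗_F M₂ for every λ ∈ ℝ). -/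
open TensorProduct

/-- The image of `U ⊗[F] U'` in `M₁ ⊗[F] M₂`, for subspaces `U ⊆ M₁`, `U' ⊆ M₂`. -/
noncomputable def tensorSub {F : Type*} [Field F] {M₁ M₂ : Type*}
    [AddCommGroup M₁] [Module F M₁] [AddCommGroup M₂] [Module F M₂]
    (U : Submodule F M₁) (U' : Submodule F M₂) : Submodule F (M₁ ⊗[F] M₂) :=
  LinearMap.range (TensorProduct.map U.subtype U'.subtype)

/-- The tensor-product filtration `L λ = Σ_{μ + ν = λ} (L₁ μ) ⊗ (L₂ ν)`. -/
noncomputable def tensorFilt {F : Type*} [Field F] {M₁ M₂ : Type*}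
    [AddCommGroup M₁] [Module F M₁] [AddCommGroup M₂] [Module F M₂]
    (L₁ : ℝ → Submodule F M₁) (L₂ : ℝ → Submodule F M₂) (l : ℝ) :
    Submodule F (M₁ ⊗[F] M₂) :=
  ⨆ (p : ℝ × ℝ) (_ : p.1 + p.2 = l), tensorSub (L₁ p.1) (L₂ p.2)

/-- If `L₁`, `L₂` are decreasing, exhaustive and everywhere proper filtrations of `M₁`, `M₂`,
then `L λ = Σ_{μ + ν = λ} (L₁ μ) ⊗ (L₂ ν)` is a decreasing, exhaustive and everywhere
proper filtration of `M₁ ⊗[F] M₂`. -/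
theorem tensorFilt_decreasing_exhaustive_proper {F : Type*} [Field F] {M₁ M₂ : Type*}
    [AddCommGroup M₁] [Module F M₁] [AddCommGroup M₂] [Module F M₂]
    (L₁ : ℝ → Submodule F M₁) (L₂ : ℝ → Submodule F M₂)
    (hdec₁ : ∀ ν μ : ℝ, ν ≤ μ → L₁ μ ≤ L₁ ν)
    (hdec₂ : ∀ ν μ : ℝ, ν ≤ μ → L₂ μ ≤ L₂ ν)
    (hex₁ : ∀ x : M₁, ∃ μ : ℝ, x ∈ L₁ μ)
    (hex₂ : ∀ x : M₂, ∃ ν : ℝ, x ∈ L₂ ν)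
    (hpr₁ : ∀ μ : ℝ, L₁ μ ≠ ⊤) (hpr₂ : ∀ ν : ℝ, L₂ ν ≠ ⊤) :
    (∀ l l' : ℝ, l ≤ l' → tensorFilt L₁ L₂ l' ≤ tensorFilt L₁ L₂ l) ∧
      (∀ x : M₁ ⊗[F] M₂, ∃ l : ℝ, x ∈ tensorFilt L₁ L₂ l) ∧
      (∀ l : ℝ, tensorFilt L₁ L₂ l ≠ ⊤) := by
  have mono : ∀ l l' : ℝ, l ≤ l' → tensorFilt L₁ L₂ l' ≤ tensorFilt L₁ L₂ l := by
    intro l l' h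
    refine iSup₂_le fun p hp => ?_
    refine le_trans ?_ (le_iSup₂_of_le (p.1, l - p.1) (by simp) le_rfl)
    rintro _ ⟨t, rfl⟩
    have hle : L₂ p.2 ≤ L₂ (l - p.1) := hdec₂ _ _ (by linarith)
    refine ⟨TensorProduct.map LinearMap.id (Submodule.inclusion hle) t, ?_⟩
    rw [← LinearMap.comp_apply, ← TensorProduct.map_comp]
    rfl
  refine ⟨mono, ?_, ?_⟩
  · intro x
    induction x using TensorProduct.induction_on with
    | zero => exact ⟨0, zero_mem _⟩
    | tmul x y =>
      obtain ⟨μ, hμ⟩ := hex₁ x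
      obtain ⟨ν, hν⟩ := hex₂ y
      refine ⟨μ + ν, ?_⟩
      refine (le_iSup₂_of_le (f := fun (p : ℝ × ℝ) (_ : p.1 + p.2 = μ + ν) =>
        tensorSub (L₁ p.1) (L₂ p.2)) (μ, ν) rfl le_rfl) ?_
      exact ⟨(⟨x, hμ⟩ : L₁ μ) ⊗ₜ (⟨y, hν⟩ : L₂ ν), by simp⟩
    | add x y hx hy =>
      obtain ⟨a, ha⟩ := hx
      obtain ⟨b, hb⟩ := hy
      exact ⟨min a b, add_mem (mono _ _ (min_le_left _ _) ha) (mono _ _ (min_le_right _ _) hb)⟩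
  · intro l htop
    obtain ⟨f, hf0, hf⟩ := Submodule.exists_le_ker_of_lt_top _ (lt_top_iff_ne_top.2 (hpr₁ l))
    obtain ⟨g, hg0, hg⟩ := Submodule.exists_le_ker_of_lt_top _ (lt_top_iff_ne_top.2 (hpr₂ 0))
    obtain ⟨x, hx⟩ : ∃ x, f x ≠ 0 := by
      by_contra! h
      exact hf0 (LinearMap.ext h)
    obtain ⟨y, hy⟩ : ∃ y, g y ≠ 0 := by
      by_contra! h
      exact hg0 (LinearMap.ext h)
    let φ : M₁ ⊗[F] M₂ →ₗ[F] F := LinearMap.mul' F F ∘ₗ TensorProduct.map f g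
    have hle : tensorFilt L₁ L₂ l ≤ LinearMap.ker φ := by
      refine iSup₂_le fun p hp => ?_
      rintro _ ⟨t, rfl⟩
      induction t using TensorProduct.induction_on with
      | zero => simp
      | add a b ha hb => rw [map_add]; exact add_mem ha hb
      | tmul a b =>
        rw [LinearMap.mem_ker]
        simp only [φ, TensorProduct.map_tmul, LinearMap.comp_apply, LinearMap.mul'_apply,
          Submodule.subtype_apply]
        rcases le_total l p.1 with h | h
        · have : f a = 0 := hf (hdec₁ _ _ h a.2)
          rw [this, zero_mul]
        · have : g b = 0 := hg (hdec₂ 0 p.2 (by linarith) b.2)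
          rw [this, mul_zero]
    have hxy : φ (x ⊗ₜ y) = 0 := hle (htop ▸ Submodule.mem_top)
    simp only [φ, TensorProduct.map_tmul, LinearMap.comp_apply, LinearMap.mul'_apply] at hxy
    exact mul_ne_zero hx hy hxy
end

section
/- Let F be a field. For i = 1, 2, let G_i be a group acting on an F-vector space M_i by F-linear automorphisms, and let φ_i : G_i → ℝ be a group homomorphism into the additive group of reals. Suppose that for i = 1, 2 the G_i-module M_i admits a nontrivial φ_i-filtration. Let the product group G₁ × G₂ act on M₁ ⊗_F M₂ via (g₁, g₂) • (x ⊗ y) = (g₁ • x) ⊗ (g₂ • y), and define φ : G₁ × G₂ → ℝ by φ(g₁, g₂) = φ₁(g₁) + φ₂(g₂). Then M₁ ⊗_F M₂ admits a nontrivial φ-filtration. (This is the inclusion p₁*Δ(M₁) + p₂*Δ(M₂) ⊆ Δ(M₁ ⊗_F M₂) of Theorem A, expressed via filtrations.) -/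
open TensorProduct

/-- A nontrivial `φ`-filtration of a `G`-module `M` (`G` acting by `F`-linear
automorphisms): a family of subspaces that is decreasing, exhaustive, everywhere proper,
and satisfies `g • (L μ) = L (μ + φ g)`. -/
def IsNontrivialFiltration (F : Type*) {G M : Type*} [Field F] [Group G]
    [AddCommGroup M] [Module F M] [DistribMulAction G M] [SMulCommClass G F M]
    (φ : G → ℝ) (L : ℝ → Submodule F M) : Prop :=
  (∀ ν μ : ℝ, ν ≤ μ → L μ ≤ L ν) ∧ (∀ x : M, ∃ μ : ℝ, x ∈ L μ) ∧ (∀ μ : ℝ, L μ ≠ ⊤) ∧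
    (∀ (g : G) (μ : ℝ),
      Submodule.map (DistribMulAction.toLinearMap F M g) (L μ) = L (μ + φ g))

/-- If `M₁` admits a nontrivial `φ₁`-filtration as `G₁`-module and `M₂` a nontrivial
`φ₂`-filtration as `G₂`-module, then `M₁ ⊗[F] M₂`, with `(g₁, g₂)` acting as
`(g₁ •) ⊗ (g₂ •)`, admits a nontrivial `φ`-filtration for `φ(g₁, g₂) = φ₁ g₁ + φ₂ g₂`.
(This is the inclusion `p₁*Δ(M₁) + p₂*Δ(M₂) ⊆ Δ(M₁ ⊗ M₂)` expressed via filtrations.) -/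
theorem tensor_nontrivial_filtration {F G₁ G₂ M₁ M₂ : Type*} [Field F]
    [Group G₁] [Group G₂]
    [AddCommGroup M₁] [Module F M₁] [DistribMulAction G₁ M₁] [SMulCommClass G₁ F M₁]
    [AddCommGroup M₂] [Module F M₂] [DistribMulAction G₂ M₂] [SMulCommClass G₂ F M₂]
    (φ₁ : G₁ → ℝ) (hφ₁ : ∀ g g' : G₁, φ₁ (g * g') = φ₁ g + φ₁ g')
    (φ₂ : G₂ → ℝ) (hφ₂ : ∀ g g' : G₂, φ₂ (g * g') = φ₂ g + φ₂ g')
    (L₁ : ℝ → Submodule F M₁) (h₁ : IsNontrivialFiltration F φ₁ L₁)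
    (L₂ : ℝ → Submodule F M₂) (h₂ : IsNontrivialFiltration F φ₂ L₂) :
    ∃ L : ℝ → Submodule F (M₁ ⊗[F] M₂),
      (∀ ν μ : ℝ, ν ≤ μ → L μ ≤ L ν) ∧
      (∀ x : M₁ ⊗[F] M₂, ∃ μ : ℝ, x ∈ L μ) ∧
      (∀ μ : ℝ, L μ ≠ ⊤) ∧
      (∀ (g₁ : G₁) (g₂ : G₂) (μ : ℝ),
        Submodule.map
          (TensorProduct.map (DistribMulAction.toLinearMap F M₁ g₁)
            (DistribMulAction.toLinearMap F M₂ g₂)) (L μ) =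
        L (μ + (φ₁ g₁ + φ₂ g₂))) := by
  obtain ⟨d₁, e₁, p₁, q₁⟩ := h₁
  obtain ⟨d₂, e₂, p₂, q₂⟩ := h₂
  have key : ∀ ν μ : ℝ, ν ≤ μ →
      (⨆ a : ℝ, Submodule.map₂ (TensorProduct.mk F M₁ M₂) (L₁ a) (L₂ (μ - a))) ≤
      (⨆ a : ℝ, Submodule.map₂ (TensorProduct.mk F M₁ M₂) (L₁ a) (L₂ (ν - a))) := by
    intro ν μ h
    exact iSup_mono fun a => Submodule.map₂_le_map₂ le_rfl (d₂ _ _ (by linarith))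
  refine ⟨fun μ => ⨆ a : ℝ, Submodule.map₂ (TensorProduct.mk F M₁ M₂) (L₁ a) (L₂ (μ - a)),
    key, ?_, ?_, ?_⟩
  · intro x
    induction x with
    | zero => exact ⟨0, Submodule.zero_mem _⟩
    | tmul x y =>
      obtain ⟨a, ha⟩ := e₁ x
      obtain ⟨b, hb⟩ := e₂ y
      refine ⟨a + b, Submodule.mem_iSup_of_mem a ?_⟩
      refine Submodule.apply_mem_map₂ (TensorProduct.mk F M₁ M₂) ha ?_
      rwa [add_sub_cancel_left]
    | add x y hx hy =>
      obtain ⟨a, ha⟩ := hx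
      obtain ⟨b, hb⟩ := hy
      exact ⟨min a b, Submodule.add_mem _ (key _ _ (min_le_left a b) ha)
        (key _ _ (min_le_right a b) hb)⟩
  · intro μ htop
    obtain ⟨f, hf, hf'⟩ := Submodule.exists_le_ker_of_lt_top _ (lt_top_iff_ne_top.2 (p₁ μ))
    obtain ⟨g, hg, hg'⟩ := Submodule.exists_le_ker_of_lt_top _ (lt_top_iff_ne_top.2 (p₂ 0))
    obtain ⟨x, hx⟩ : ∃ x, f x ≠ 0 := by
      by_contra! h
      exact hf (LinearMap.ext h)
    obtain ⟨y, hy⟩ : ∃ y, g y ≠ 0 := by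
      by_contra! h
      exact hg (LinearMap.ext h)
    have hle : (⨆ a : ℝ, Submodule.map₂ (TensorProduct.mk F M₁ M₂) (L₁ a) (L₂ (μ - a))) ≤
        LinearMap.ker (LinearMap.mul' F F ∘ₗ TensorProduct.map f g) := by
      refine iSup_le fun a => Submodule.map₂_le.2 fun u hu v hv => ?_
      rw [LinearMap.mem_ker]
      simp only [TensorProduct.mk_apply, LinearMap.comp_apply, TensorProduct.map_tmul,
        LinearMap.mul'_apply]
      rcases le_total μ a with h | h
      · have : f u = 0 := hf' (d₁ _ _ h hu)
        rw [this, zero_mul]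
      · have : g v = 0 := hg' (d₂ 0 _ (by linarith) hv)
        rw [this, mul_zero]
    have hm : x ⊗ₜ[F] y ∈ LinearMap.ker (LinearMap.mul' F F ∘ₗ TensorProduct.map f g) :=
      hle (by
        have h := Submodule.mem_top (R := F) (x := x ⊗ₜ[F] y)
        rw [← htop] at h
        exact h)
    rw [LinearMap.mem_ker] at hm
    simp only [LinearMap.comp_apply, TensorProduct.map_tmul, LinearMap.mul'_apply] at hm
    exact mul_ne_zero hx hy hm
  · intro g₁ g₂ μ
    have hstep : ∀ a : ℝ, Submodule.map
          (TensorProduct.map (DistribMulAction.toLinearMap F M₁ g₁)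
            (DistribMulAction.toLinearMap F M₂ g₂))
          (Submodule.map₂ (TensorProduct.mk F M₁ M₂) (L₁ a) (L₂ (μ - a))) =
        Submodule.map₂ (TensorProduct.mk F M₁ M₂) (L₁ (a + φ₁ g₁))
          (L₂ (μ + (φ₁ g₁ + φ₂ g₂) - (a + φ₁ g₁))) := by
      intro a
      have e : μ + (φ₁ g₁ + φ₂ g₂) - (a + φ₁ g₁) = (μ - a) + φ₂ g₂ := by ring
      rw [e, ← q₁, ← q₂, Submodule.map₂_map_map, Submodule.map_map₂]
      congr 1
    simp only [Submodule.map_iSup, hstep]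
    exact (Equiv.addRight (φ₁ g₁)).iSup_comp
      (g := fun a => Submodule.map₂ (TensorProduct.mk F M₁ M₂) (L₁ a)
          (L₂ (μ + (φ₁ g₁ + φ₂ g₂) - a)))
end
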